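/- arXiv:1909.04918 — 3 statements merged into one kernel-verified Lean document; each statement's English description precedes it below -/
import Mathlib

section
/- Let N ≥ 1 be an integer, C > 0 and R > 0 real numbers, and let f(z) = ∑_{k=0}^∞ a_k z^k be an analytic function on the disk D_R = {z : |z| < R} which is not constant, and which satisfies the Taylor domination property excluding the constant term: |a_k|·R^k ≤ C·max_{1≤i≤N} |a_i|·R^i for all k ≥ N+1. Then for any R' with 0 < R' < R/4, for every c ∈ ℂ the set {z : |z| < R', f(z) = c} is finite and has at most 5N + 5·log(C+2) elements (log denoting natural logarithm); that is, f is (5N + 5·log(C+2))-valent in D_{R'}. -/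
open Metric

theorem norm_sub_coeff_zero_le {b : ℕ → ℂ} {K r : ℝ} (hK : ∀ k, 1 ≤ k → ‖b k‖ ≤ K)
    (hr1 : r < 1) {z w : ℂ} (hz : ‖z‖ ≤ r) (hw : HasSum (fun k => b k * z ^ k) w) :
    ‖w - b 0‖ ≤ K * (r / (1 - r)) := by
  have hr0 : 0 ≤ r := (norm_nonneg z).trans hz
  have hK0 : 0 ≤ K := (norm_nonneg _).trans (hK 1 le_rfl)
  have hshift := (hasSum_nat_add_iff' 1).mpr hw
  simp only [Finset.sum_range_one, pow_zero, mul_one] at hshift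
  have hgeom := ((hasSum_geometric_of_lt_one hr0 hr1).mul_left (K * r))
  have hbound := hshift.norm_le_of_bounded hgeom fun k => by
    rw [norm_mul, norm_pow]
    calc ‖b (k + 1)‖ * ‖z‖ ^ (k + 1) ≤ K * r ^ (k + 1) := by
          gcongr
          exact hK _ (by omega)
      _ = K * r * r ^ k := by ring
  rwa [mul_assoc, ← div_eq_mul_inv] at hbound

theorem hasFPowerSeriesOnBall_ofScalars_of_bounded {b : ℕ → ℂ} {F : ℂ → ℂ} {B : ℝ}
    (hF : ∀ z ∈ ball (0 : ℂ) 1, HasSum (fun k => b k * z ^ k) (F z)) (hb : ∀ k, ‖b k‖ ≤ B) :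
    HasFPowerSeriesOnBall F (FormalMultilinearSeries.ofScalars ℂ b) 0 1 where
  r_le := by
    have := (FormalMultilinearSeries.ofScalars ℂ b).le_radius_of_bound B (r := 1) fun n => by
      simpa [FormalMultilinearSeries.ofScalars_norm] using hb n
    simpa using this
  r_pos := one_pos
  hasSum {y} hy := by
    have hy' : y ∈ ball (0 : ℂ) 1 := by
      rw [← ENNReal.ofReal_one, eball_ofReal] at hy
      exact hy
    simpa only [FormalMultilinearSeries.ofScalars_apply_eq, smul_eq_mul, zero_add] using hF y hy'

theorem norm_coeff_le_of_forall_mem_sphere_norm_le {b : ℕ → ℂ} {F : ℂ → ℂ}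
    (hF : HasFPowerSeriesOnBall F (FormalMultilinearSeries.ofScalars ℂ b) 0 1)
    {r A : ℝ} (hr0 : 0 < r) (hdiff : DiffContOnCl ℂ F (ball 0 r))
    (hA : ∀ z ∈ sphere (0 : ℂ) r, ‖F z‖ ≤ A) (n : ℕ) : ‖b n‖ ≤ A / r ^ n := by
  have hcauchy := Complex.norm_iteratedDeriv_le_of_forall_mem_sphere_norm_le n hr0 hdiff hA
  have hcoeff := hF.factorial_smul 1 n
  rw [FormalMultilinearSeries.ofScalars_apply_eq, ← iteratedDeriv_eq_iteratedFDeriv] at hcoeff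
  rw [← hcoeff] at hcauchy
  simp only [one_pow, smul_eq_mul, mul_one, nsmul_eq_mul, norm_mul, Complex.norm_natCast,
    mul_div_assoc] at hcauchy
  exact le_of_mul_le_mul_left hcauchy (by exact_mod_cast n.factorial_pos)

theorem norm_blaschke_numerator_eq {z w : ℂ} (hz : ‖z‖ = 3 / 4) :
    ‖9 / 16 - (starRingEnd ℂ) w * z‖ = 3 / 4 * ‖z - w‖ := by
  have hzz : z * (starRingEnd ℂ) z = 9 / 16 := by
    rw [Complex.mul_conj, Complex.normSq_eq_norm_sq, hz]
    norm_num
  rw [← hzz, show z * (starRingEnd ℂ) z - (starRingEnd ℂ) w * z = z * (starRingEnd ℂ) (z - w) by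
    rw [map_sub]; ring, norm_mul, Complex.norm_conj, hz]

theorem norm_sub_le_blaschke_numerator {z w : ℂ} (hz : ‖z‖ ≤ 1 / 4) (hw : ‖w‖ ≤ 1 / 4) :
    3 / 4 * ‖z - w‖ ≤ 3 / 5 * ‖9 / 16 - (starRingEnd ℂ) w * z‖ := by
  have hz2 : Complex.normSq z ≤ 1 / 16 := by
    rw [Complex.normSq_eq_norm_sq]
    nlinarith [norm_nonneg z]
  have hw2 : Complex.normSq w ≤ 1 / 16 := by
    rw [Complex.normSq_eq_norm_sq]
    nlinarith [norm_nonneg w]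
  have hsum := Complex.normSq_nonneg (z + w)
  have hnum : Complex.normSq (9 / 16 - (starRingEnd ℂ) w * z) =
      81 / 256 - 9 / 8 * (z * (starRingEnd ℂ) w).re + Complex.normSq z * Complex.normSq w := by
    rw [Complex.normSq_sub, map_mul, map_mul, map_div₀, Complex.normSq_conj,
      Complex.conj_conj]
    simp only [Complex.normSq_ofNat]
    have : (9 / 16 * (w * (starRingEnd ℂ) z) : ℂ).re = 9 / 16 * (z * (starRingEnd ℂ) w).re := by
      rw [show (9 / 16 : ℂ) = ((9 / 16 : ℝ) : ℂ) by norm_num, Complex.re_ofReal_mul]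
      simp only [Complex.mul_re, Complex.conj_re, Complex.conj_im]
      ring
    rw [this]
    ring
  rw [Complex.normSq_add] at hsum
  refine abs_le_of_sq_le_sq' ?_ (by positivity) |>.2
  rw [mul_pow, mul_pow, ← Complex.normSq_eq_norm_sq, ← Complex.normSq_eq_norm_sq, hnum,
    Complex.normSq_sub]
  nlinarith [mul_nonneg (sub_nonneg.mpr hz2) (sub_nonneg.mpr hw2)]

/-- Each zero in `‖z‖ ≤ 1/4` improves the maximum modulus bound there by the factor `3/5`. -/
theorem norm_le_pow_card_mul_of_zeros {A : ℝ} (S : Finset ℂ) : ∀ {F : ℂ → ℂ},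
    DifferentiableOn ℂ F (ball 0 1) → (∀ z ∈ sphere (0 : ℂ) (3 / 4), ‖F z‖ ≤ A) →
    (∀ w ∈ S, ‖w‖ ≤ 1 / 4 ∧ F w = 0) → ∀ z : ℂ, ‖z‖ ≤ 1 / 4 →
    ‖F z‖ ≤ (3 / 5) ^ S.card * A := by
  induction S using Finset.induction_on with
  | empty =>
    intro F hF hA _ z hz
    have hsub : closedBall (0 : ℂ) (3 / 4) ⊆ ball 0 1 := closedBall_subset_ball (by norm_num)
    have := Complex.norm_le_of_forall_mem_frontier_norm_le (U := ball (0 : ℂ) (3 / 4))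
      isBounded_ball ((hF.mono hsub).diffContOnCl_ball subset_rfl)
      (fun z hz => hA z (frontier_ball_subset_sphere hz))
      (subset_closure (mem_ball_zero_iff.mpr (by linarith : ‖z‖ < 3 / 4)))
    simpa using this
  | insert w S hwS ih =>
    intro F hF hA hS z hz
    obtain ⟨hw, hFw⟩ := hS w (Finset.mem_insert_self w S)
    have hfactor : ∀ x, F x = (x - w) * dslope F w x := fun x => by
      simpa [hFw] using (sub_smul_dslope F w x).symm
    set G : ℂ → ℂ := fun x => dslope F w x * ((9 / 16 - (starRingEnd ℂ) w * x) / (3 / 4))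
      with hGdef
    have hG : DifferentiableOn ℂ G (ball 0 1) := by
      refine DifferentiableOn.mul ?_ (by fun_prop)
      exact (Complex.differentiableOn_dslope
        (isOpen_ball.mem_nhds (mem_ball_zero_iff.mpr (by linarith)))).mpr hF
    have hGA : ∀ x ∈ sphere (0 : ℂ) (3 / 4), ‖G x‖ ≤ A := fun x hx => by
      have hnum := norm_blaschke_numerator_eq (w := w) (mem_sphere_zero_iff_norm.mp hx)
      have hFx := hA x hx
      rw [hfactor, norm_mul] at hFx
      simp only [hGdef, norm_mul, norm_div, hnum]
      norm_num
      linarith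
    have hGS : ∀ v ∈ S, ‖v‖ ≤ 1 / 4 ∧ G v = 0 := fun v hv => by
      obtain ⟨hv1, hFv⟩ := hS v (Finset.mem_insert_of_mem hv)
      refine ⟨hv1, ?_⟩
      have hne : v - w ≠ 0 := sub_ne_zero.mpr fun h => hwS (h ▸ hv)
      have hd : dslope F w v = 0 :=
        (mul_eq_zero.mp ((hfactor v).symm.trans hFv)).resolve_left hne
      simp [hGdef, hd]
    have hstep : ‖F z‖ ≤ 3 / 5 * ‖G z‖ := by
      have hnum := mul_le_mul_of_nonneg_right (norm_sub_le_blaschke_numerator hz hw)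
        (norm_nonneg (dslope F w z))
      rw [hfactor]
      simp only [hGdef, norm_mul, norm_div]
      norm_num at hnum ⊢
      linarith
    rw [Finset.card_insert_of_notMem hwS, pow_succ]
    linarith [ih hG hGA hGS z hz]

theorem le_of_pow_five_thirds_le {n N : ℕ} {C : ℝ} (hN : 1 ≤ N) (hC : 0 < C)
    (h : (5 / 3 : ℝ) ^ n ≤ 4 ^ N * (10 / 3 * (C + 1))) :
    (n : ℝ) ≤ 5 * N + 5 * Real.log (C + 2) := by
  have hN' : (1 : ℝ) ≤ N := by exact_mod_cast hN
  have h4 : Real.log 4 = 2 * Real.log 2 := by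
    rw [show (4 : ℝ) = 2 ^ 2 by norm_num, Real.log_pow]
    norm_num
  have h53 : 1 / 2 ≤ Real.log (5 / 3) := by
    have hsq : Real.log ((5 / 3) ^ 2) = 2 * Real.log (5 / 3) := by
      rw [Real.log_pow]
      norm_num
    have h1 : 1 ≤ Real.log ((5 / 3) ^ 2) := by
      rw [Real.le_log_iff_exp_le (by norm_num)]
      linarith [Real.exp_one_lt_d9]
    linarith
  have hle : (5 / 3 : ℝ) ^ n ≤ 4 ^ N * (4 * (C + 2)) := h.trans (by gcongr <;> norm_num)
  have hlog := Real.log_le_log (by positivity) hle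
  rw [Real.log_mul (by positivity) (by positivity), Real.log_mul (by norm_num) (by positivity),
    Real.log_pow, Real.log_pow, h4] at hlog
  have hC2 : Real.log 2 ≤ Real.log (C + 2) := Real.log_le_log (by norm_num) (by linarith)
  have hn : (n : ℝ) * (1 / 2) ≤ n * Real.log (5 / 3) := by gcongr
  nlinarith [Real.log_two_lt_d9, Real.log_two_gt_d9]

theorem card_zeros_le_of_taylor_domination {N : ℕ} (hN : 1 ≤ N) {C M : ℝ} (hC : 0 < C)
    (hM : 0 < M) {b : ℕ → ℂ} {F : ℂ → ℂ}
    (hF : ∀ z ∈ ball (0 : ℂ) 1, HasSum (fun k => b k * z ^ k) (F z))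
    (hle : ∀ k, 1 ≤ k → k ≤ N → ‖b k‖ ≤ M) (hmax : ∃ k ≤ N, M ≤ ‖b k‖)
    (htail : ∀ k, N + 1 ≤ k → ‖b k‖ ≤ C * M) (S : Finset ℂ)
    (hS : ∀ w ∈ S, ‖w‖ ≤ 1 / 4 ∧ F w = 0) :
    (S.card : ℝ) ≤ 5 * N + 5 * Real.log (C + 2) := by
  rcases S.eq_empty_or_nonempty with rfl | ⟨w, hwS⟩
  · have : 0 ≤ Real.log (C + 2) := Real.log_nonneg (by linarith)
    simp only [Finset.card_empty, Nat.cast_zero]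
    positivity
  set K := (C + 1) * M with hKdef
  have hK : ∀ k, 1 ≤ k → ‖b k‖ ≤ K := fun k hk => by
    rcases le_or_gt k N with h | h
    · nlinarith [hle k hk h]
    · nlinarith [htail k h]
  have hK0 : 0 < K := by positivity
  have hb0 : ‖b 0‖ ≤ K / 3 := by
    obtain ⟨hw, hFw⟩ := hS w hwS
    have := norm_sub_coeff_zero_le hK (by norm_num) hw
      (hF w (mem_ball_zero_iff.mpr (by linarith)))
    rw [hFw, zero_sub, norm_neg] at this
    linarith
  have hbdd : ∀ k, ‖b k‖ ≤ K := fun k => by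
    rcases k.eq_zero_or_pos with rfl | hk
    · linarith
    · exact hK k hk
  have hseries := hasFPowerSeriesOnBall_ofScalars_of_bounded hF hbdd
  have hdiff : DifferentiableOn ℂ F (ball 0 1) := by
    have := hseries.differentiableOn
    rwa [← ENNReal.ofReal_one, eball_ofReal] at this
  have hA : ∀ z ∈ sphere (0 : ℂ) (3 / 4), ‖F z‖ ≤ 10 / 3 * K := fun z hz => by
    have hz' := mem_sphere_zero_iff_norm.mp hz
    have := norm_sub_coeff_zero_le hK (by norm_num) hz'.le
      (hF z (mem_ball_zero_iff.mpr (by linarith)))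
    have htri := norm_add_le (F z - b 0) (b 0)
    rw [sub_add_cancel] at htri
    linarith
  have hsmall := norm_le_pow_card_mul_of_zeros S hdiff hA hS
  obtain ⟨k, hkN, hk⟩ := hmax
  have hcoeff := norm_coeff_le_of_forall_mem_sphere_norm_le hseries (r := 1 / 4) (by norm_num)
    ((hdiff.mono (closedBall_subset_ball (by norm_num))).diffContOnCl_ball subset_rfl)
    (fun z hz => hsmall z (mem_sphere_zero_iff_norm.mp hz).le) k
  refine le_of_pow_five_thirds_le hN hC ?_
  have hpow : (4 : ℝ) ^ k ≤ 4 ^ N := pow_le_pow_right₀ (by norm_num) hkN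
  have hMle : M ≤ (3 / 5) ^ S.card * (10 / 3 * K) * 4 ^ N := by
    calc M ≤ (3 / 5) ^ S.card * (10 / 3 * K) / (1 / 4) ^ k := hk.trans hcoeff
      _ = (3 / 5) ^ S.card * (10 / 3 * K) * 4 ^ k := by
        rw [one_div, inv_pow, div_inv_eq_mul]
      _ ≤ _ := by gcongr
  have hinv : (5 / 3 : ℝ) ^ S.card * (3 / 5) ^ S.card = 1 := by
    rw [← mul_pow]
    norm_num
  refine le_of_mul_le_mul_right ?_ hM
  calc (5 / 3 : ℝ) ^ S.card * M
      ≤ (5 / 3) ^ S.card * ((3 / 5) ^ S.card * (10 / 3 * K) * 4 ^ N) := by gcongr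
    _ = ((5 / 3) ^ S.card * (3 / 5) ^ S.card) * (10 / 3 * K) * 4 ^ N := by ring
    _ = 4 ^ N * (10 / 3 * (C + 1)) * M := by rw [hinv, hKdef]; ring

theorem finite_and_ncard_le_of_forall_finset {α : Type*} {s : Set α} {B : ℝ}
    (h : ∀ S : Finset α, (S : Set α) ⊆ s → (S.card : ℝ) ≤ B) :
    s.Finite ∧ (s.ncard : ℝ) ≤ B := by
  have hfin : s.Finite := by
    by_contra hinf
    obtain ⟨n, hn⟩ := exists_nat_gt B
    obtain ⟨S, hSs, hcard⟩ := Set.Infinite.exists_subset_card_eq hinf n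
    have := h S hSs
    rw [hcard] at this
    linarith
  refine ⟨hfin, ?_⟩
  rw [Set.ncard_eq_toFinset_card s hfin]
  exact h _ (by simp)


/-- **Valency under Taylor domination excluding the constant term.**
If `f(z) = ∑ aₖ zᵏ` is analytic on `D_R`, not constant, and satisfies
`|aₖ|·Rᵏ ≤ C·max_{1≤i≤N}|aᵢ|·Rⁱ` for all `k ≥ N+1`, then for every `0 < R' < R/4`
the function `f` is `(5N + 5·log(C+2))`-valent in `D_{R'}`: for every `c ∈ ℂ` the
equation `f(z) = c` has at most `5N + 5·log(C+2)` solutions with `|z| < R'`. -/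
theorem valency_of_taylor_domination (N : ℕ) (hN : 1 ≤ N) (C R : ℝ) (hC : 0 < C) (hR : 0 < R)
    (a : ℕ → ℂ) (f : ℂ → ℂ)
    (hf : ∀ z ∈ Metric.ball (0 : ℂ) R, HasSum (fun k : ℕ => a k * z ^ k) (f z))
    (hnc : ¬ ∃ c : ℂ, ∀ z ∈ Metric.ball (0 : ℂ) R, f z = c)
    (hdom : ∀ k : ℕ, N + 1 ≤ k →
      ‖a k‖ * R ^ k ≤ C * (Finset.Icc 1 N).sup' (Finset.nonempty_Icc.mpr hN)
        (fun i => ‖a i‖ * R ^ i))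
    (R' : ℝ) (hR'0 : 0 < R') (hR' : R' < R / 4) :
    ∀ c : ℂ,
      {z : ℂ | ‖z‖ < R' ∧ f z = c}.Finite ∧
      ({z : ℂ | ‖z‖ < R' ∧ f z = c}.ncard : ℝ) ≤ 5 * N + 5 * Real.log (C + 2) := by
  intro c
  refine finite_and_ncard_le_of_forall_finset fun S hS => ?_
  set M := (Finset.Icc 1 N).sup' (Finset.nonempty_Icc.mpr hN) (fun i => ‖a i‖ * R ^ i) with hMdef
  have hleM : ∀ k, 1 ≤ k → k ≤ N → ‖a k‖ * R ^ k ≤ M := fun k h1 h2 =>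
    Finset.le_sup' (fun i => ‖a i‖ * R ^ i) (Finset.mem_Icc.mpr ⟨h1, h2⟩)
  obtain ⟨m, hm, hmM⟩ := Finset.exists_mem_eq_sup' (Finset.nonempty_Icc.mpr hN)
    (fun i => ‖a i‖ * R ^ i)
  rw [← hMdef] at hmM
  have hmN := Finset.mem_Icc.mp hm
  have hM : 0 < M := by
    by_contra! hM0
    refine hnc ⟨a 0, fun z hz => ?_⟩
    have ha : ∀ k, k ≠ 0 → a k = 0 := fun k hk => by
      have hle : ‖a k‖ * R ^ k ≤ 0 := by
        rcases le_or_gt k N with h | h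
        · exact (hleM k (Nat.pos_of_ne_zero hk) h).trans hM0
        · exact (hdom k h).trans (mul_nonpos_of_nonneg_of_nonpos hC.le hM0)
      exact norm_le_zero_iff.mp (nonpos_of_mul_nonpos_left hle (pow_pos hR k))
    have h0 := hasSum_single (f := fun k => a k * z ^ k) 0 fun k hk => by simp [ha k hk]
    simpa using (hf z hz).unique h0
  have hRc : (R : ℂ) ≠ 0 := by exact_mod_cast hR.ne'
  set b : ℕ → ℂ := fun k => a k * R ^ k - if k = 0 then c else 0 with hbdef
  have hb : ∀ k, 1 ≤ k → ‖b k‖ = ‖a k‖ * R ^ k := fun k hk => by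
    simp [hbdef, Nat.ne_of_gt hk, abs_of_pos hR]
  have hF : ∀ z ∈ Metric.ball (0 : ℂ) 1,
      HasSum (fun k => b k * z ^ k) (f (R * z) - c) := fun z hz => by
    have hRz : (R : ℂ) * z ∈ Metric.ball (0 : ℂ) R := by
      rw [mem_ball_zero_iff] at hz ⊢
      rw [norm_mul, Complex.norm_real, Real.norm_of_nonneg hR.le]
      nlinarith
    have hterm : (fun k => b k * z ^ k) = fun k => a k * (R * z) ^ k - if k = 0 then c else 0 := by
      funext k
      rcases eq_or_ne k 0 with rfl | hk
      · simp [hbdef]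
      · simp only [hbdef, hk, if_false]
        ring
    exact hterm ▸ (hf _ hRz).sub (hasSum_ite_eq 0 c)
  have hinj : Function.Injective fun w : ℂ => w / R := fun x y hxy => by
    simpa [div_left_inj' hRc] using hxy
  rw [← Finset.card_image_of_injective S hinj]
  refine card_zeros_le_of_taylor_domination hN hC hM hF
    (fun k h1 h2 => (hb k h1).trans_le (hleM k h1 h2))
    ⟨m, hmN.2, (hmM.trans (hb m hmN.1).symm).le⟩
    (fun k hk => (hb k (by omega)).trans_le (hdom k hk)) _ fun w hw => ?_
  obtain ⟨v, hv, rfl⟩ := Finset.mem_image.mp hw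
  obtain ⟨hv1, hv2⟩ := hS hv
  refine ⟨?_, ?_⟩
  · rw [norm_div, Complex.norm_real, Real.norm_of_nonneg hR.le, div_le_iff₀ hR]
    linarith
  · rw [mul_div_cancel₀ _ hRc, hv2, sub_self]
end

section
/- There exists an absolute constant K > 0 with the following property. Let p ≥ 1 be an integer, A ≥ 1 a real number, and f(z) = ∑_{k=0}^∞ a_k z^k an analytic function on the unit disk D_1, not constant, whose coefficients satisfy the Biernacki-type Taylor domination |a_k| ≤ A·k^{2p-1}·max_{1≤i≤p} |a_i| for all integers k ≥ p+1. Then for every c ∈ ℂ, the set {z : |z| < 1/5, f(z) = c} is finite and has at most K·( p·(1 + log(p+1)) + log A ) elements; that is, f is of valency at most K·( p·(1 + log(p+1)) + log A ) in the disk D_{1/5} (log denoting natural logarithm). -/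
open Metric in
/-- A function that is the sum of a scalar power series on the open unit disk has that series as
its power series there. -/
theorem hasFPowerSeriesOnBall_ofScalars_of_hasSum {b : ℕ → ℂ} {g : ℂ → ℂ}
    (h : ∀ z ∈ ball (0 : ℂ) 1, HasSum (fun k : ℕ => b k * z ^ k) (g z)) :
    HasFPowerSeriesOnBall g (FormalMultilinearSeries.ofScalars ℂ b) 0 1 where
  r_le := by
    refine ENNReal.le_of_forall_nnreal_lt fun r hr => ?_
    have hr1 : (r : ℝ) < 1 := by exact_mod_cast hr
    refine FormalMultilinearSeries.le_radius_of_tendsto _ (l := 0) ?_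
    have hs := (h (r : ℂ) (by simpa using hr1)).summable.tendsto_atTop_zero.norm
    simpa [FormalMultilinearSeries.ofScalars_norm] using hs
  r_pos := one_pos
  hasSum := by
    intro y hy
    have hy1 : y ∈ ball (0 : ℂ) 1 := by
      simpa [← Metric.eball_ofReal] using hy
    simpa [FormalMultilinearSeries.ofScalars_apply_eq, mul_comm] using h y hy1

open Metric in
theorem analyticOnNhd_ball_of_hasSum {b : ℕ → ℂ} {g : ℂ → ℂ}
    (h : ∀ z ∈ ball (0 : ℂ) 1, HasSum (fun k : ℕ => b k * z ^ k) (g z)) :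
    AnalyticOnNhd ℂ g (ball 0 1) := by
  have := (hasFPowerSeriesOnBall_ofScalars_of_hasSum h).analyticOnNhd
  rwa [← ENNReal.ofReal_one, Metric.eball_ofReal] at this

open Metric in
/-- Cauchy's estimate for the coefficients of a power series on the unit disk. -/
theorem norm_coeff_le_of_hasSum {b : ℕ → ℂ} {g : ℂ → ℂ} {r C : ℝ}
    (h : ∀ z ∈ ball (0 : ℂ) 1, HasSum (fun k : ℕ => b k * z ^ k) (g z))
    (hr : 0 < r) (hr1 : r < 1) (hC : ∀ z ∈ closedBall (0 : ℂ) r, ‖g z‖ ≤ C) (n : ℕ) :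
    ‖b n‖ ≤ C / r ^ n := by
  have hp := hasFPowerSeriesOnBall_ofScalars_of_hasSum h
  have hdc : DiffContOnCl ℂ g (ball 0 r) :=
    ((analyticOnNhd_ball_of_hasSum h).differentiableOn.mono (closedBall_subset_ball hr1)).diffContOnCl_ball subset_rfl
  have h1 := Complex.norm_iteratedDeriv_le_of_forall_mem_sphere_norm_le n hr hdc
    fun z hz => hC z (sphere_subset_closedBall hz)
  have h2 := hp.factorial_smul 1 n
  rw [← iteratedDeriv_eq_iteratedFDeriv] at h2
  rw [← h2] at h1
  have hn : (0 : ℝ) < n.factorial := by positivity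
  simp only [FormalMultilinearSeries.ofScalars_apply_eq, one_pow, smul_eq_mul, mul_one,
    nsmul_eq_mul, norm_mul, Complex.norm_natCast, mul_div_assoc] at h1
  exact le_of_mul_le_mul_left h1 hn

open Metric in
/-- **Jensen's inequality** for the number of distinct zeros in a closed disk. -/
theorem AnalyticOnNhd.ncard_zeros_le {c : ℂ} {r R M : ℝ} {g : ℂ → ℂ} (hr : 0 < r) (hrR : r < R)
    (hg : AnalyticOnNhd ℂ g (closedBall c R)) (hc : g c ≠ 0)
    (hM : ∀ z ∈ closedBall c R, ‖g z‖ ≤ M) :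
    {z | z ∈ closedBall c r ∧ g z = 0}.Finite ∧
      ({z | z ∈ closedBall c r ∧ g z = 0}.ncard : ℝ) ≤
        Real.log (M / ‖g c‖) / Real.log (R / r) := by
  have hR : 0 < R := hr.trans hrR
  have hgc : 0 < ‖g c‖ := norm_pos_iff.mpr hc
  let u : ℂ → ℂ := fun z => (g c)⁻¹ * g z
  have hu : AnalyticOnNhd ℂ u (closedBall c R) := fun z hz => analyticAt_const.mul (hg z hz)
  have huc : u c = 1 := inv_mul_cancel₀ hc
  have hur : AnalyticOnNhd ℂ u (closedBall c r) := hu.mono (closedBall_subset_closedBall hrR.le)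
  have huM : ∀ z ∈ closedBall c R, ‖u z‖ ≤ M / ‖g c‖ := fun z hz => by
    rw [norm_mul, norm_inv, inv_mul_eq_div]
    exact div_le_div_of_nonneg_right (hM z hz) hgc.le
  have h1M : 1 ≤ M / ‖g c‖ := by simpa [huc] using huM c (mem_closedBall_self hR.le)
  have key := AnalyticOnNhd.sum_divisor_le (c := c) (r := r) (R := R) (f := u)
    (by rwa [abs_of_pos hr]) (by rwa [abs_of_pos hr, abs_of_pos hR]) h1M
    (by rwa [abs_of_pos hR]) (by simp [huc])
    (fun z hz => huM z (sphere_subset_closedBall (by rwa [abs_of_pos hR] at hz)))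
  rw [huc, norm_one, div_one, abs_of_pos hr] at key
  set D := MeromorphicOn.divisor u (closedBall c r) with hD
  have hfin : D.support.Finite := D.finiteSupport (isCompact_closedBall c r)
  have hpos : ∀ z, z ∈ closedBall c r → g z = 0 → 1 ≤ D z := by
    intro z hz hgz
    have htop : analyticOrderAt u z ≠ ⊤ :=
      hur.analyticOrderAt_ne_top_of_isPreconnected (convex_closedBall c r).isPreconnected
        (mem_closedBall_self hr.le) hz
        (by rw [((hur c (mem_closedBall_self hr.le)).analyticOrderAt_eq_zero).mpr
              (by simp [huc])]; simp)
    have hne : analyticOrderAt u z ≠ 0 :=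
      (hur z hz).analyticOrderAt_ne_zero.mpr (by simp [u, hgz])
    rw [hD, MeromorphicOn.AnalyticOnNhd.divisor_apply hur hz]
    lift analyticOrderAt u z to ℕ using htop with n
    have hn : n ≠ 0 := by exact_mod_cast hne
    have : (1 : ℤ) ≤ (n : ℤ) := by omega
    simpa using this
  have hnn : ∀ z, 0 ≤ D z := fun z => MeromorphicOn.AnalyticOnNhd.divisor_nonneg hur z
  have hsub : {z | z ∈ closedBall c r ∧ g z = 0} ⊆ D.support := fun z hz => by
    have := hpos z hz.1 hz.2
    exact Function.mem_support.mpr (by omega)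
  have hZ := hfin.subset hsub
  refine ⟨hZ, le_trans ?_ key⟩
  have hle : (({z | z ∈ closedBall c r ∧ g z = 0}.ncard : ℕ) : ℤ) ≤ ∑ᶠ z, D z := by
    rw [finsum_eq_sum_of_support_subset (s := hfin.toFinset) D (by simp),
      Set.ncard_eq_toFinset_card _ hZ, Finset.cast_card]
    calc ∑ z ∈ hZ.toFinset, (1 : ℤ) ≤ ∑ z ∈ hZ.toFinset, D z :=
          Finset.sum_le_sum fun z hz => by
            have := (hZ.mem_toFinset).mp hz
            exact hpos z this.1 this.2
      _ ≤ ∑ z ∈ hfin.toFinset, D z :=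
          Finset.sum_le_sum_of_subset_of_nonneg (by simpa using hsub) fun z _ _ => hnn z
  exact_mod_cast hle

theorem pow_mul_four_fifths_pow_le (n k : ℕ) :
    (k : ℝ) ^ n * (4 / 5 : ℝ) ^ k ≤ (n.factorial * 10 ^ n : ℝ) * (9 / 10) ^ k := by
  have h1 := Real.pow_div_factorial_le_exp (x := (k : ℝ) * (1 / 10)) (by positivity) n
  have hexp : Real.exp (1 / 10) ≤ 9 / 8 := by
    have h := Real.add_one_le_exp (-(1 / 10) : ℝ)
    rw [Real.exp_neg] at h
    have h3 : (9 / 10 : ℝ) ≤ (Real.exp (1 / 10))⁻¹ := by linarith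
    have h4 := inv_anti₀ (by norm_num) h3
    rw [inv_inv] at h4
    norm_num at h4 ⊢
    linarith
  rw [Real.exp_nat_mul] at h1
  have h2 : Real.exp (1 / 10) ^ k ≤ (9 / 8 : ℝ) ^ k :=
    pow_le_pow_left₀ (Real.exp_pos _).le hexp k
  have hn : (0 : ℝ) < n.factorial := by positivity
  rw [div_le_iff₀ hn, mul_pow, one_div, inv_pow, ← one_div] at h1
  have h5 : (k : ℝ) ^ n ≤ n.factorial * 10 ^ n * (9 / 8 : ℝ) ^ k := by
    have h6 : (k : ℝ) ^ n = (k : ℝ) ^ n * ((10 : ℝ) ^ n)⁻¹ * 10 ^ n := by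
      field_simp
    rw [h6]
    calc _ ≤ (Real.exp (1 / 10) ^ k * n.factorial) * 10 ^ n :=
          mul_le_mul_of_nonneg_right (by simpa using h1) (by positivity)
      _ ≤ ((9 / 8 : ℝ) ^ k * n.factorial) * 10 ^ n := by gcongr
      _ = _ := by ring
  calc (k : ℝ) ^ n * (4 / 5 : ℝ) ^ k
      ≤ n.factorial * 10 ^ n * (9 / 8 : ℝ) ^ k * (4 / 5 : ℝ) ^ k := by gcongr
    _ = n.factorial * 10 ^ n * ((9 / 8) * (4 / 5)) ^ k := by rw [mul_pow]; ring
    _ = _ := by norm_num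

/-- Growth bound on `|z| ≤ 4/5` from polynomially growing Taylor coefficients. -/
theorem norm_le_of_coeff_le_pow {b : ℕ → ℂ} {w z : ℂ} {B C : ℝ} {n : ℕ} (hC : 0 ≤ C)
    (h : HasSum (fun k : ℕ => b k * z ^ k) w) (hz : ‖z‖ ≤ 4 / 5) (hb0 : ‖b 0‖ ≤ B)
    (hb : ∀ k, 1 ≤ k → ‖b k‖ ≤ C * (k : ℝ) ^ n) :
    ‖w‖ ≤ B + 10 * (C * (n.factorial * 10 ^ n)) := by
  have hB : 0 ≤ B := (norm_nonneg _).trans hb0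
  have hgeo : HasSum (fun k : ℕ => C * (n.factorial * 10 ^ n : ℝ) * (9 / 10 : ℝ) ^ k)
      (C * (n.factorial * 10 ^ n : ℝ) * 10) := by
    have := hasSum_geometric_of_lt_one (r := (9 / 10 : ℝ)) (by norm_num) (by norm_num)
    rw [show (1 - 9 / 10 : ℝ)⁻¹ = 10 by norm_num] at this
    exact this.mul_left _
  have hsum := (hasSum_ite_eq (0 : ℕ) B).add hgeo
  have hle : ∀ k, ‖b k * z ^ k‖ ≤
      (if k = 0 then B else 0) + C * (n.factorial * 10 ^ n : ℝ) * (9 / 10 : ℝ) ^ k := by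
    intro k
    rcases Nat.eq_zero_or_pos k with rfl | hk
    · have : 0 ≤ C * (n.factorial * 10 ^ n : ℝ) := by positivity
      simp only [pow_zero, mul_one, if_true]
      linarith
    · rw [if_neg hk.ne', zero_add, norm_mul, norm_pow]
      calc ‖b k‖ * ‖z‖ ^ k ≤ C * (k : ℝ) ^ n * (4 / 5) ^ k := by
            gcongr
            exact hb k hk
        _ = C * ((k : ℝ) ^ n * (4 / 5) ^ k) := by ring
        _ ≤ C * ((n.factorial * 10 ^ n : ℝ) * (9 / 10) ^ k) :=
            mul_le_mul_of_nonneg_left (pow_mul_four_fifths_pow_le n k) hC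
        _ = _ := by ring
  have := h.norm_le_of_bounded hsum hle
  linarith

theorem log_growth_ratio_le {p : ℕ} (hp : 1 ≤ p) {A : ℝ} (hA : 1 ≤ A) :
    Real.log (1 + 10 * (A * 5 ^ p * ((2 * p - 1).factorial * 10 ^ (2 * p - 1)))) ≤
      42 * ((p : ℝ) * (1 + Real.log ((p : ℝ) + 1)) + Real.log A) := by
  have hp1 : (1 : ℝ) ≤ p := by exact_mod_cast hp
  have hX : (((2 * p - 1).factorial : ℝ) * 10 ^ (2 * p - 1)) ≤ (20 * p : ℝ) ^ (2 * p - 1) := by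
    have h1 : (2 * p - 1).factorial ≤ (2 * p) ^ (2 * p - 1) :=
      (Nat.factorial_le_pow _).trans (Nat.pow_le_pow_left (by omega) _)
    have h2 : ((2 * p - 1).factorial : ℝ) ≤ (2 * p : ℝ) ^ (2 * p - 1) := by exact_mod_cast h1
    calc _ ≤ (2 * p : ℝ) ^ (2 * p - 1) * 10 ^ (2 * p - 1) := by gcongr
      _ = _ := by rw [← mul_pow]; ring
  have hY : 1 + 10 * (A * 5 ^ p * ((2 * p - 1).factorial * 10 ^ (2 * p - 1))) ≤
      A * 5 ^ p * (20 * p : ℝ) ^ (2 * p) := by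
    have h5 : (1 : ℝ) ≤ 5 ^ p := one_le_pow₀ (by norm_num)
    have hAp : 1 ≤ A * 5 ^ p := one_le_mul_of_one_le_of_one_le hA h5
    have hX1 : (1 : ℝ) ≤ (20 * p : ℝ) ^ (2 * p - 1) := one_le_pow₀ (by linarith)
    have h1 : 1 ≤ A * 5 ^ p * (20 * p : ℝ) ^ (2 * p - 1) :=
      one_le_mul_of_one_le_of_one_le hAp hX1
    have h2 : A * 5 ^ p * (((2 * p - 1).factorial : ℝ) * 10 ^ (2 * p - 1)) ≤
        A * 5 ^ p * (20 * p : ℝ) ^ (2 * p - 1) := by gcongr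
    have h3 : (20 * p : ℝ) ^ (2 * p) = (20 * p : ℝ) ^ (2 * p - 1) * (20 * p) := by
      rw [← pow_succ]; congr 1; omega
    rw [h3, ← mul_assoc]
    nlinarith
  have hlA : 0 ≤ Real.log A := Real.log_nonneg hA
  have hlp : Real.log p ≤ Real.log ((p : ℝ) + 1) := Real.log_le_log (by linarith) (by linarith)
  have hlp1 : 0 ≤ Real.log ((p : ℝ) + 1) := Real.log_nonneg (by linarith)
  have h5 : Real.log 5 ≤ 4 := by
    linarith [Real.log_le_sub_one_of_pos (show (0 : ℝ) < 5 by norm_num)]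
  have h20 : Real.log 20 ≤ 19 := by
    linarith [Real.log_le_sub_one_of_pos (show (0 : ℝ) < 20 by norm_num)]
  refine (Real.log_le_log (by positivity) hY).trans ?_
  rw [Real.log_mul (by positivity) (by positivity), Real.log_mul (by positivity) (by positivity),
    Real.log_pow, Real.log_pow, Real.log_mul (by positivity) (by positivity)]
  push_cast
  have e1 : (p : ℝ) * Real.log 5 ≤ p * 4 := by gcongr
  have e2 : 2 * (p : ℝ) * (Real.log 20 + Real.log p) ≤
      2 * p * (19 + Real.log ((p : ℝ) + 1)) := by gcongr
  have e3 : 0 ≤ (p : ℝ) * Real.log ((p : ℝ) + 1) := by positivity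
  nlinarith

open Metric in
/-- Zero count on the disk of radius `1/5` for a function whose Taylor coefficients are dominated
by the first `p` of them. -/
theorem ncard_zeros_le_of_taylor_domination {p : ℕ} (hp : 1 ≤ p) {A : ℝ} (hA : 1 ≤ A)
    {b : ℕ → ℂ} {g : ℂ → ℂ}
    (h : ∀ z ∈ ball (0 : ℂ) 1, HasSum (fun k : ℕ => b k * z ^ k) (g z))
    (hne : ∃ z ∈ ball (0 : ℂ) 1, g z ≠ 0)
    (hdom : ∀ k : ℕ, p + 1 ≤ k →
      ‖b k‖ ≤ A * (k : ℝ) ^ (2 * p - 1) *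
        (Finset.Icc 1 p).sup' (Finset.nonempty_Icc.mpr hp) (fun i => ‖b i‖)) :
    {z : ℂ | ‖z‖ < 1 / 5 ∧ g z = 0}.Finite ∧
      ({z : ℂ | ‖z‖ < 1 / 5 ∧ g z = 0}.ncard : ℝ) ≤
        126 * ((p : ℝ) * (1 + Real.log ((p : ℝ) + 1)) + Real.log A) := by
  have hana := analyticOnNhd_ball_of_hasSum h
  obtain ⟨w, hw, hmax⟩ := (isCompact_closedBall (0 : ℂ) (1 / 5)).exists_isMaxOn
    (nonempty_closedBall.mpr (by norm_num))
    (hana.continuousOn.mono (closedBall_subset_ball (by norm_num))).norm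
  have hcoeff : ∀ k, ‖b k‖ ≤ ‖g w‖ * 5 ^ k := fun k => by
    simpa using norm_coeff_le_of_hasSum h (r := 1 / 5) (by norm_num) (by norm_num)
      (fun z hz => hmax hz) k
  have hgw : g w ≠ 0 := by
    intro h0
    have hb : ∀ k, b k = 0 := fun k => by simpa [h0] using hcoeff k
    obtain ⟨z, hz, hgz⟩ := hne
    exact hgz ((h z hz).unique (by simp [hb]))
  have hbk : ∀ k, 1 ≤ k → ‖b k‖ ≤ (‖g w‖ * (A * 5 ^ p)) * (k : ℝ) ^ (2 * p - 1) := by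
    intro k hk
    have hk1 : (1 : ℝ) ≤ (k : ℝ) ^ (2 * p - 1) := one_le_pow₀ (by exact_mod_cast hk)
    have hsmall : ∀ i, i ≤ p → ‖b i‖ ≤ ‖g w‖ * 5 ^ p := fun i hi =>
      (hcoeff i).trans (by gcongr; norm_num)
    rcases le_or_gt k p with hkp | hkp
    · calc ‖b k‖ ≤ ‖g w‖ * 5 ^ p := hsmall k hkp
        _ = ‖g w‖ * (1 * 5 ^ p) * 1 := by ring
        _ ≤ _ := by gcongr
    · calc ‖b k‖ ≤ A * (k : ℝ) ^ (2 * p - 1) *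
            (Finset.Icc 1 p).sup' (Finset.nonempty_Icc.mpr hp) (fun i => ‖b i‖) := hdom k hkp
        _ ≤ A * (k : ℝ) ^ (2 * p - 1) * (‖g w‖ * 5 ^ p) := by
            gcongr
            exact Finset.sup'_le _ _ fun i hi => hsmall i (Finset.mem_Icc.mp hi).2
        _ = _ := by ring
  have hw5 : dist w 0 ≤ 1 / 5 := hw
  have hsub : closedBall w (3 / 5) ⊆ closedBall (0 : ℂ) (4 / 5) :=
    closedBall_subset_closedBall' (by linarith)
  have hM : ∀ z ∈ closedBall w (3 / 5), ‖g z‖ ≤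
      ‖g w‖ + 10 * (‖g w‖ * (A * 5 ^ p) * ((2 * p - 1).factorial * 10 ^ (2 * p - 1))) := by
    intro z hz
    have hz' := hsub hz
    exact norm_le_of_coeff_le_pow (by positivity)
      (h z (closedBall_subset_ball (by norm_num) hz')) (by simpa using hz')
      (by simpa using hcoeff 0) hbk
  obtain ⟨hfin, hcard⟩ := AnalyticOnNhd.ncard_zeros_le (r := 2 / 5) (by norm_num) (by norm_num)
    (hana.mono (hsub.trans (closedBall_subset_ball (by norm_num)))) hgw hM
  have hZ : {z : ℂ | ‖z‖ < 1 / 5 ∧ g z = 0} ⊆ {z | z ∈ closedBall w (2 / 5) ∧ g z = 0} := by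
    rintro z ⟨hz, hgz⟩
    refine ⟨?_, hgz⟩
    rw [mem_closedBall]
    have := dist_triangle_right z w 0
    rw [dist_zero_right z] at this
    linarith
  refine ⟨hfin.subset hZ, ?_⟩
  have hcard' : ({z : ℂ | ‖z‖ < 1 / 5 ∧ g z = 0}.ncard : ℝ) ≤
      {z | z ∈ closedBall w (2 / 5) ∧ g z = 0}.ncard := by
    exact_mod_cast Set.ncard_le_ncard hZ hfin
  have hg0 : 0 < ‖g w‖ := norm_pos_iff.mpr hgw
  have hratio : (‖g w‖ + 10 * (‖g w‖ * (A * 5 ^ p) *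
      ((2 * p - 1).factorial * 10 ^ (2 * p - 1)))) / ‖g w‖ =
      1 + 10 * (A * 5 ^ p * ((2 * p - 1).factorial * 10 ^ (2 * p - 1))) := by
    field_simp
  rw [hratio] at hcard
  have hlog : (1 / 3 : ℝ) ≤ Real.log (3 / 5 / (2 / 5)) := by
    have := Real.one_sub_inv_le_log_of_pos (show (0 : ℝ) < 3 / 5 / (2 / 5) by norm_num)
    norm_num at this ⊢
    linarith
  have hS := log_growth_ratio_le hp hA
  have hS0 : 0 ≤ 42 * ((p : ℝ) * (1 + Real.log ((p : ℝ) + 1)) + Real.log A) := by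
    have := Real.log_nonneg hA
    have : 0 ≤ Real.log ((p : ℝ) + 1) := Real.log_nonneg (by simp)
    positivity
  refine hcard'.trans (hcard.trans ?_)
  rw [div_le_iff₀ (by linarith)]
  nlinarith


/-- There is an absolute constant `K > 0` such that every non-constant analytic function
`f(z) = ∑ aₖ zᵏ` on the unit disk whose coefficients satisfy the Biernacki-type Taylor
domination `|aₖ| ≤ A·k^(2p-1)·max_{1≤i≤p}|aᵢ|` for `k ≥ p+1` (with `p ≥ 1`, `A ≥ 1`)
is of valency at most `K·(p·(1 + log(p+1)) + log A)` in the disk `D_{1/5}`. -/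
theorem valency_from_biernacki_domination :
    ∃ K : ℝ, 0 < K ∧
      ∀ (p : ℕ) (hp : 1 ≤ p) (A : ℝ), 1 ≤ A →
      ∀ (a : ℕ → ℂ) (f : ℂ → ℂ),
        (∀ z ∈ Metric.ball (0 : ℂ) 1, HasSum (fun k : ℕ => a k * z ^ k) (f z)) →
        (¬ ∃ c : ℂ, ∀ z ∈ Metric.ball (0 : ℂ) 1, f z = c) →
        (∀ k : ℕ, p + 1 ≤ k →
          ‖a k‖ ≤ A * (k : ℝ) ^ (2 * p - 1) *
            (Finset.Icc 1 p).sup' (Finset.nonempty_Icc.mpr hp) (fun i => ‖a i‖)) →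
        ∀ c : ℂ,
          {z : ℂ | ‖z‖ < 1 / 5 ∧ f z = c}.Finite ∧
          ({z : ℂ | ‖z‖ < 1 / 5 ∧ f z = c}.ncard : ℝ) ≤
            K * ((p : ℝ) * (1 + Real.log ((p : ℝ) + 1)) + Real.log A) := by
  refine ⟨126, by norm_num, fun p hp A hA a f hf hnc hdom c => ?_⟩
  have hupd : ∀ i, 1 ≤ i → Function.update a 0 (a 0 - c) i = a i := fun i hi =>
    Function.update_of_ne (by omega) _ _
  have hsup : (Finset.Icc 1 p).sup' (Finset.nonempty_Icc.mpr hp)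
      (fun i => ‖Function.update a 0 (a 0 - c) i‖) =
      (Finset.Icc 1 p).sup' (Finset.nonempty_Icc.mpr hp) (fun i => ‖a i‖) :=
    Finset.sup'_congr _ rfl fun i hi => by rw [hupd i (Finset.mem_Icc.mp hi).1]
  have hsum : ∀ z ∈ Metric.ball (0 : ℂ) 1,
      HasSum (fun k : ℕ => Function.update a 0 (a 0 - c) k * z ^ k) (f z - c) := by
    intro z hz
    convert! (hf z hz).sub (hasSum_ite_eq (0 : ℕ) c) using 2 with k
    rcases Nat.eq_zero_or_pos k with rfl | hk
    · simp
    · simp [hk.ne']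
  have hne : ∃ z ∈ Metric.ball (0 : ℂ) 1, f z - c ≠ 0 := by
    by_contra! hall
    exact hnc ⟨c, fun z hz => sub_eq_zero.mp (hall z hz)⟩
  have key := ncard_zeros_le_of_taylor_domination hp hA hsum hne fun k hk => by
    rw [hsup, hupd k (by omega)]
    exact hdom k hk
  simpa only [sub_eq_zero] using key
end

section
/- Let p ≥ 1 be an integer and R > 0 a real number such that R^p/(2π) is not an integer. Then the set {z ∈ ℂ : |z| < R, exp(z^p) = 1} has exactly 2p·⌊R^p/(2π)⌋ + 1 elements. -/
/-- A nonzero complex number has exactly `n` distinct `n`-th roots. -/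
theorem Complex.card_nthRootsFinset_of_ne_zero {n : ℕ} (hn : n ≠ 0) {a : ℂ} (ha : a ≠ 0) :
    (Polynomial.nthRootsFinset n a).card = n := by
  classical
  have hζ := Complex.isPrimitiveRoot_exp n hn
  have hroot : ∃ α : ℂ, α ^ n = a := IsAlgClosed.exists_pow_nat_eq a (Nat.pos_of_ne_zero hn)
  rw [Polynomial.nthRootsFinset_def, Multiset.toFinset_card_of_nodup (hζ.nthRoots_nodup ha),
    hζ.card_nthRoots, if_pos hroot]

/-- The solutions of `exp (z ^ p) = 1` in a disk, sorted by the value `2πik` of `z ^ p`. -/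
theorem exp_pow_eq_one_iff_exists_abs_le {p : ℕ} (hp : p ≠ 0) {R : ℝ} (hR : 0 < R)
    (h : ∀ n : ℤ, (n : ℝ) ≠ R ^ p / (2 * Real.pi)) (z : ℂ) :
    (‖z‖ < R ∧ Complex.exp (z ^ p) = 1) ↔
      ∃ k : ℤ, k.natAbs ≤ Nat.floor (R ^ p / (2 * Real.pi)) ∧
        z ^ p = k * (2 * Real.pi * Complex.I) := by
  have hπ : 0 < 2 * Real.pi := Real.two_pi_pos
  have key : ∀ k : ℤ, z ^ p = k * (2 * Real.pi * Complex.I) →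
      (‖z‖ < R ↔ k.natAbs ≤ Nat.floor (R ^ p / (2 * Real.pi))) := by
    intro k hk
    have hnorm : ‖z‖ ^ p = k.natAbs * (2 * Real.pi) := by
      rw [← norm_pow, hk]
      simp [abs_of_pos Real.pi_pos, Nat.cast_natAbs]
    have hne : (k.natAbs : ℝ) ≠ R ^ p / (2 * Real.pi) := by
      simpa using h (k.natAbs : ℤ)
    rw [← pow_lt_pow_iff_left₀ (norm_nonneg z) hR.le hp, hnorm, ← lt_div_iff₀ hπ,
      Nat.le_floor_iff (by positivity)]
    exact ⟨le_of_lt, fun hle => lt_of_le_of_ne hle hne⟩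
  rw [Complex.exp_eq_one_iff]
  constructor
  · rintro ⟨hz, k, hk⟩
    exact ⟨k, (key k hk).1 hz, hk⟩
  · rintro ⟨k, hkN, hk⟩
    exact ⟨(key k hk).2 hkN, k, hk⟩

/-- For `p ≥ 1` and `R > 0` with `R^p/(2π)` not an integer, the equation
`exp(z^p) = 1` has exactly `2p·⌊R^p/(2π)⌋ + 1` solutions in the disk `D_R`. -/
theorem exp_pow_eq_one_count (p : ℕ) (hp : 1 ≤ p) (R : ℝ) (hR : 0 < R)
    (h : ∀ n : ℤ, (n : ℝ) ≠ R ^ p / (2 * Real.pi)) :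
    {z : ℂ | ‖z‖ < R ∧ Complex.exp (z ^ p) = 1}.Finite ∧
    {z : ℂ | ‖z‖ < R ∧ Complex.exp (z ^ p) = 1}.ncard =
      2 * p * Nat.floor (R ^ p / (2 * Real.pi)) + 1 := by
  classical
  have hp0 : p ≠ 0 := Nat.one_le_iff_ne_zero.mp hp
  set N := Nat.floor (R ^ p / (2 * Real.pi)) with hN
  let K : Finset ℤ := (Finset.Icc (-(N : ℤ)) N).erase 0
  let roots : ℤ → Finset ℂ :=
    fun k => Polynomial.nthRootsFinset p ((k : ℂ) * (2 * Real.pi * Complex.I))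
  have mem_roots : ∀ k z, z ∈ roots k ↔ z ^ p = k * (2 * Real.pi * Complex.I) :=
    fun k z => Polynomial.mem_nthRootsFinset hp _
  have hset : {z : ℂ | ‖z‖ < R ∧ Complex.exp (z ^ p) = 1} =
      ((insert 0 (K.biUnion roots) : Finset ℂ) : Set ℂ) := by
    ext z
    rw [Set.mem_ofPred_eq, exp_pow_eq_one_iff_exists_abs_le hp0 hR h, ← hN, Finset.mem_coe,
      Finset.mem_insert, Finset.mem_biUnion]
    simp only [mem_roots, K, Finset.mem_erase, Finset.mem_Icc]
    constructor
    · rintro ⟨k, hkN, hk⟩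
      rcases eq_or_ne k 0 with rfl | hk0
      · left
        simpa [hp0] using hk
      · exact Or.inr ⟨k, ⟨hk0, by omega, by omega⟩, hk⟩
    · rintro (rfl | ⟨k, ⟨-, hk1, hk2⟩, hk⟩)
      · exact ⟨0, by simp, by simp [hp0]⟩
      · exact ⟨k, by omega, hk⟩
  have hcardK : K.card = 2 * N := by
    rw [Finset.card_erase_of_mem (by simp), Int.card_Icc]
    omega
  have hdisj : (K : Set ℤ).PairwiseDisjoint roots := by
    intro j _ k _ hjk
    refine Finset.disjoint_left.mpr fun z hj hk => hjk ?_
    rw [mem_roots] at hj hk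
    exact_mod_cast mul_right_cancel₀ Complex.two_pi_I_ne_zero (hj.symm.trans hk)
  have hcard : ∀ k ∈ K, (roots k).card = p := fun k hk =>
    Complex.card_nthRootsFinset_of_ne_zero hp0 <|
      mul_ne_zero (Int.cast_ne_zero.mpr (Finset.ne_of_mem_erase hk)) Complex.two_pi_I_ne_zero
  have hzero : (0 : ℂ) ∉ K.biUnion roots := by
    rw [Finset.mem_biUnion]
    rintro ⟨k, hk, h0⟩
    rw [mem_roots, zero_pow hp0] at h0
    exact mul_ne_zero (Int.cast_ne_zero.mpr (Finset.ne_of_mem_erase hk))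
      Complex.two_pi_I_ne_zero h0.symm
  rw [hset]
  refine ⟨Finset.finite_toSet _, ?_⟩
  rw [Set.ncard_coe_finset, Finset.card_insert_of_notMem hzero, Finset.card_biUnion hdisj,
    Finset.sum_congr rfl hcard, Finset.sum_const, hcardK, smul_eq_mul]
  ring
end
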